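/- Let n ≥ 3, p ≥ (n+2)/(n−2), and let D ⊂ ℝⁿ be an open ball centered at the origin. Then there is no pair of radially symmetric functions u, v ∈ C²(D) ∩ C¹(closure of D) with u > 0 and v > 0 in D, u = v = 0 on ∂D, satisfying −Δu = √p · u^{p−1} v and −Δv = √p · u^p in D. -/

import Mathlib

open MeasureTheory Real Filter

/-- The Laplacian of `u : ℝⁿ → ℝ`, as the sum of second partial derivatives. -/
noncomputable def lap {n : ℕ} (u : EuclideanSpace ℝ (Fin n) → ℝ)
    (x : EuclideanSpace ℝ (Fin n)) : ℝ :=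
  ∑ i : Fin n, iteratedFDeriv ℝ 2 u x ![EuclideanSpace.single i 1, EuclideanSpace.single i 1]

open Topology

/-- A Pohozaev-type nonexistence result for the radial ODE system with dimension `k + 2`. -/
theorem radial_system_false (k : ℕ) (p : ℝ)
    (hp1 : 1 < p) (hp : (k : ℝ) + 4 ≤ p * k) (R : ℝ) (hR : 0 < R)
    (U U' U'' V V' V'' : ℝ → ℝ)
    (hU : ContinuousOn U (Set.Icc 0 R)) (hU' : ContinuousOn U' (Set.Icc 0 R))
    (hV : ContinuousOn V (Set.Icc 0 R)) (hV' : ContinuousOn V' (Set.Icc 0 R))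
    (dU : ∀ r ∈ Set.Ioo 0 R, HasDerivAt U (U' r) r)
    (dU' : ∀ r ∈ Set.Ioo 0 R, HasDerivAt U' (U'' r) r)
    (dV : ∀ r ∈ Set.Ioo 0 R, HasDerivAt V (V' r) r)
    (dV' : ∀ r ∈ Set.Ioo 0 R, HasDerivAt V' (V'' r) r)
    (posU : ∀ r ∈ Set.Ioo 0 R, 0 < U r) (posV : ∀ r ∈ Set.Ioo 0 R, 0 < V r)
    (bU : U R = 0) (bV : V R = 0)
    (eU : ∀ r ∈ Set.Ioo 0 R, -(U'' r + (k + 1) * (U' r / r)) = √p * U r ^ (p - 1) * V r)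
    (eV : ∀ r ∈ Set.Ioo 0 R, -(V'' r + (k + 1) * (V' r / r)) = √p * U r ^ p) : False := by
  have p0 : 0 < p := by linarith
  have hs : 0 < √p := Real.sqrt_pos.2 p0
  have hsq : √p * √p = p := Real.mul_self_sqrt p0.le
  have hflux : StrictAntiOn (fun r => r ^ (k + 1) * U' r) (Set.Icc 0 R) := by
    refine strictAntiOn_of_hasDerivWithinAt_neg
      (f' := fun r => -(r ^ (k + 1) * (√p * U r ^ (p - 1) * V r))) (convex_Icc 0 R) (by fun_prop)
      (fun r hr => ?_) (fun r hr => ?_)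
    · rw [interior_Icc] at hr
      refine HasDerivAt.hasDerivWithinAt ?_
      refine ((hasDerivAt_pow (k + 1) r).mul (dU' r hr)).congr_deriv ?_
      have := hr.1.ne'
      rw [← eU r hr]
      simp only [Nat.add_sub_cancel]
      push_cast
      field_simp
      ring
    · rw [interior_Icc] at hr
      have h1 := Real.rpow_pos_of_pos (posU r hr) (p - 1)
      have h2 := posV r hr
      have h3 := hr.1
      have : 0 < r ^ (k + 1) * (√p * U r ^ (p - 1) * V r) := by positivity
      simpa using this
  have hneg : R ^ (k + 1) * U' R < 0 := by
    simpa using hflux (Set.left_mem_Icc.2 hR.le) (Set.right_mem_Icc.2 hR.le) hR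
  have hUR : U' R ≠ 0 := by
    rintro h
    simp [h] at hneg
  have hpoh : AntitoneOn (fun r => r ^ (k + 2) * ((U' r ^ 2 + V' r ^ 2 / p) / 2
      + U r ^ p * V r / √p)
      + k / 2 * (r ^ (k + 1) * (U r * U' r + V r * V' r / p))) (Set.Icc 0 R) := by
    have hUp : ContinuousOn (fun r => U r ^ p) (Set.Icc 0 R) :=
      hU.rpow_const fun _ _ => Or.inr p0.le
    refine antitoneOn_of_hasDerivWithinAt_nonpos
      (f' := fun r => r ^ (k + 1) * (U r ^ p * V r / √p) * ((k + 2) - k / 2 * (p + 1)))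
      (convex_Icc 0 R) (by fun_prop) (fun r hr => ?_) (fun r hr => ?_)
    · rw [interior_Icc] at hr
      refine HasDerivAt.hasDerivWithinAt ?_
      have h1 := dU r hr
      have h2 := dU' r hr
      have h3 := dV r hr
      have h4 := dV' r hr
      have h5 := h1.rpow_const (p := p) (Or.inl (posU r hr).ne')
      refine (((hasDerivAt_pow (k + 2) r).mul ((((h2.pow 2).add ((h4.pow 2).div_const p)).div_const
        2).add ((h5.mul h3).div_const √p))).add (((hasDerivAt_pow (k + 1) r).mul
          ((h1.mul h2).add ((h3.mul h4).div_const p))).const_mul (k / 2 : ℝ))).congr_deriv ?_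
      have hr0 := hr.1.ne'
      have e1 : U'' r = -(√p * U r ^ (p - 1) * V r) - (k + 1) * (U' r / r) := by
        linarith [eU r hr]
      have e2 : V'' r = -(√p * U r ^ p) - (k + 1) * (V' r / r) := by
        linarith [eV r hr]
      have e3 : U r ^ p = U r ^ (p - 1) * U r := by
        rw [Real.rpow_sub_one (posU r hr).ne', div_mul_cancel₀ _ (posU r hr).ne']
      simp only [Pi.mul_apply, Pi.add_apply, Pi.pow_apply, e1, e2, e3]
      generalize U r ^ (p - 1) = X
      generalize √p = s at *
      subst hsq
      push_cast
      field_simp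
      ring
    · rw [interior_Icc] at hr
      have h1 := Real.rpow_pos_of_pos (posU r hr) p
      have h2 := posV r hr
      have h3 := hr.1
      exact mul_nonpos_of_nonneg_of_nonpos (by positivity) (by linarith)
  have hle := hpoh (Set.left_mem_Icc.2 hR.le) (Set.right_mem_Icc.2 hR.le) hR.le
  simp only [bU, bV] at hle
  have : 0 < R ^ (k + 2) * ((U' R ^ 2 + V' R ^ 2 / p) / 2) := by positivity
  simp at hle
  linarith

theorem hasDerivAt_fderiv_line {E : Type*} [NormedAddCommGroup E] [NormedSpace ℝ E] {f : E → ℝ}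
    {x : E} (hf : ContDiffAt ℝ 2 f x) (w : E) :
    HasDerivAt (fun t : ℝ => fderiv ℝ f (x + t • w) w) (iteratedFDeriv ℝ 2 f x ![w, w]) 0 := by
  have h1 : DifferentiableAt ℝ (fderiv ℝ f) x :=
    (hf.fderiv_right (m := 1) (by norm_num)).differentiableAt (by norm_num)
  have hline : HasDerivAt (fun t : ℝ => x + t • w) w 0 := by
    simpa using ((hasDerivAt_id (0 : ℝ)).smul_const w).const_add x
  have h2 : HasFDerivAt (fderiv ℝ f) (fderiv ℝ (fderiv ℝ f) x) (x + (0 : ℝ) • w) := by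
    rw [zero_smul, add_zero]
    exact h1.hasFDerivAt
  have h3 : HasDerivAt (fun t : ℝ => fderiv ℝ f (x + t • w)) (fderiv ℝ (fderiv ℝ f) x w) 0 :=
    h2.comp_hasDerivAt (0 : ℝ) hline
  rw [iteratedFDeriv_two_apply]
  exact (ContinuousLinearMap.apply ℝ ℝ w).hasFDerivAt.comp_hasDerivAt (0 : ℝ) h3

theorem hasDerivAt_line {E : Type*} [NormedAddCommGroup E] [NormedSpace ℝ E] {f : E → ℝ}
    {x w : E} {t : ℝ} (hf : DifferentiableAt ℝ f (x + t • w)) :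
    HasDerivAt (fun s : ℝ => f (x + s • w)) (fderiv ℝ f (x + t • w) w) t := by
  have hline : HasDerivAt (fun s : ℝ => x + s • w) w t := by
    simpa using ((hasDerivAt_id t).smul_const w).const_add x
  exact hf.hasFDerivAt.comp_hasDerivAt t hline

theorem norm_add_smul_of_inner_eq_zero {E : Type*} [NormedAddCommGroup E] [InnerProductSpace ℝ E]
    {e w : E} (he : ‖e‖ = 1) (hw : ‖w‖ = 1) (h : inner ℝ e w = 0) (r t : ℝ) :
    ‖r • e + t • w‖ = √(r ^ 2 + t ^ 2) := by
  rw [← Real.sqrt_sq (norm_nonneg _), norm_add_sq_real, inner_smul_left, inner_smul_right, h]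
  simp [norm_smul, he, hw]

/-- The second derivative of a radial function in a direction tangential to the sphere. -/
theorem iteratedFDeriv_two_tangential {E : Type*} [NormedAddCommGroup E] [InnerProductSpace ℝ E]
    {R : ℝ} {u : E → ℝ}
    (hrad : ∀ x ∈ Metric.closedBall (0 : E) R, ∀ y ∈ Metric.closedBall (0 : E) R,
      ‖x‖ = ‖y‖ → u x = u y)
    (hu : ContDiffOn ℝ 2 u (Metric.ball 0 R)) {e w : E} (he : ‖e‖ = 1) (hw : ‖w‖ = 1)
    (h : inner ℝ e w = 0) {r : ℝ} (hr : r ∈ Set.Ioo 0 R) :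
    iteratedFDeriv ℝ 2 u (r • e) ![w, w] = fderiv ℝ u (r • e) e / r := by
  have hat : ∀ x : E, ‖x‖ < R → ContDiffAt ℝ 2 u x := fun x hx =>
    hu.contDiffAt (Metric.isOpen_ball.mem_nhds (by simpa using hx))
  have hr0 := hr.1
  have hφ : ∀ t : ℝ, HasDerivAt (fun t => √(r ^ 2 + t ^ 2)) (t / √(r ^ 2 + t ^ 2)) t := by
    intro t
    have h1 : HasDerivAt (fun t : ℝ => r ^ 2 + t ^ 2) (2 * t) t := by
      simpa using (hasDerivAt_pow 2 t).const_add (r ^ 2)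
    refine (h1.sqrt (by positivity)).congr_deriv ?_
    field_simp
  have hφ0 : √(r ^ 2 + 0 ^ 2) = r := by simp [Real.sqrt_sq hr0.le]
  have hre : ‖r • e‖ = r := by simp [norm_smul, he, abs_of_pos hr0]
  have hsmall : ∀ᶠ t : ℝ in 𝓝 0, √(r ^ 2 + t ^ 2) < R := by
    refine (hφ 0).continuousAt.eventually_lt continuousAt_const ?_
    rw [hφ0]; exact hr.2
  have hne : ∀ t : ℝ, ‖√(r ^ 2 + t ^ 2) • e‖ = √(r ^ 2 + t ^ 2) := by
    intro t
    simp [norm_smul, he, abs_of_nonneg (Real.sqrt_nonneg _)]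
  have hnw := norm_add_smul_of_inner_eq_zero he hw h r
  have hfst : ∀ᶠ t : ℝ in 𝓝 0, fderiv ℝ u (r • e + t • w) w
      = t * (fderiv ℝ u (√(r ^ 2 + t ^ 2) • e) e / √(r ^ 2 + t ^ 2)) := by
    filter_upwards [hsmall.eventually_nhds] with t ht
    have d1 := hasDerivAt_line (w := w)
      ((hat (r • e + t • w) (by rw [hnw]; exact ht.self_of_nhds)).differentiableAt (by norm_num))
    have d2 : HasDerivAt (fun s : ℝ => u (s • e)) (fderiv ℝ u (√(r ^ 2 + t ^ 2) • e) e)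
        √(r ^ 2 + t ^ 2) := by
      have := hasDerivAt_line (f := u) (x := 0) (w := e) (t := √(r ^ 2 + t ^ 2))
        ((hat _ (by rw [zero_add, hne]; exact ht.self_of_nhds)).differentiableAt (by norm_num))
      simpa using this
    have d3 := d2.comp t (hφ t)
    have heq : (fun s : ℝ => u (r • e + s • w)) =ᶠ[𝓝 t]
        (fun s : ℝ => u (s • e)) ∘ fun s => √(r ^ 2 + s ^ 2) := by
      filter_upwards [ht] with s hs
      refine hrad _ ?_ _ ?_ ?_
      · simpa [hnw] using hs.le
      · simpa [hne] using hs.le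
      · rw [hnw, hne]
    rw [d1.unique (d3.congr_of_eventuallyEq heq)]
    ring
  have hd := (hasDerivAt_fderiv_line (hat (r • e) (by rw [hre]; exact hr.2)) w)
  have hcont : ContinuousAt
      (fun t : ℝ => fderiv ℝ u (√(r ^ 2 + t ^ 2) • e) e / √(r ^ 2 + t ^ 2)) 0 := by
    have c1 : ContinuousAt (fderiv ℝ u) (√(r ^ 2 + 0 ^ 2) • e) := by
      rw [hφ0]
      exact ((hat (r • e) (by rw [hre]; exact hr.2)).fderiv_right
        (m := 1) (by norm_num)).continuousAt
    have c2 : ContinuousAt (fun t : ℝ => √(r ^ 2 + t ^ 2) • e) 0 :=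
      (hφ 0).continuousAt.smul continuousAt_const
    have c3 : ContinuousAt (fun t : ℝ => fderiv ℝ u (√(r ^ 2 + t ^ 2) • e)) 0 :=
      ContinuousAt.comp (f := fun t : ℝ => √(r ^ 2 + t ^ 2) • e) c1 c2
    exact (c3.clm_apply continuousAt_const).div (hφ 0).continuousAt (by rw [hφ0]; exact hr0.ne')
  have hd2 : HasDerivAt
      (fun t : ℝ => t * (fderiv ℝ u (√(r ^ 2 + t ^ 2) • e) e / √(r ^ 2 + t ^ 2)))
      (fderiv ℝ u (r • e) e / r) 0 := by
    rw [hasDerivAt_iff_tendsto_slope]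
    have := hcont.tendsto
    rw [hφ0] at this
    refine (this.mono_left nhdsWithin_le_nhds).congr' ?_
    filter_upwards [self_mem_nhdsWithin] with t ht
    have : t ≠ 0 := ht
    simp only [slope_def_field]
    field_simp
    simp
    ring
  exact hd.unique (hd2.congr_of_eventuallyEq hfst)

/-- The radial profile of a radial `C²(B) ∩ C¹(closure B)` function, with the polar form of the
Laplacian. -/
theorem exists_radial_profile (n : ℕ) (i₀ : Fin n) {R : ℝ} (hR : 0 < R)
    {u : EuclideanSpace ℝ (Fin n) → ℝ}
    (hrad : ∀ x ∈ Metric.closedBall (0 : EuclideanSpace ℝ (Fin n)) R,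
      ∀ y ∈ Metric.closedBall (0 : EuclideanSpace ℝ (Fin n)) R, ‖x‖ = ‖y‖ → u x = u y)
    (hu2 : ContDiffOn ℝ 2 u (Metric.ball 0 R)) (hu1 : ContDiffOn ℝ 1 u (Metric.closedBall 0 R)) :
    ∃ U' U'' : ℝ → ℝ,
      ContinuousOn (fun r : ℝ => u (r • EuclideanSpace.single i₀ 1)) (Set.Icc 0 R) ∧
      ContinuousOn U' (Set.Icc 0 R) ∧
      (∀ r ∈ Set.Ioo 0 R,
        HasDerivAt (fun r : ℝ => u (r • EuclideanSpace.single i₀ 1)) (U' r) r) ∧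
      (∀ r ∈ Set.Ioo 0 R, HasDerivAt U' (U'' r) r) ∧
      (∀ r ∈ Set.Ioo 0 R, lap u (r • EuclideanSpace.single i₀ 1)
        = U'' r + ((n : ℝ) - 1) * (U' r / r)) := by
  set e : EuclideanSpace ℝ (Fin n) := EuclideanSpace.single i₀ 1 with he_def
  have he : ‖e‖ = 1 := by simp [e]
  have hat : ∀ r ∈ Set.Ioo 0 R, ContDiffAt ℝ 2 u (r • e) := fun r hr =>
    hu2.contDiffAt (Metric.isOpen_ball.mem_nhds (by
      simpa [norm_smul, he, abs_of_pos hr.1] using hr.2))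
  have hC1 : ContDiffOn ℝ 1 (fun r : ℝ => u (r • e)) (Set.Icc 0 R) := by
    refine hu1.comp (by fun_prop) fun r hr => ?_
    simpa [norm_smul, he, abs_of_nonneg hr.1] using hr.2
  have hd : ∀ r ∈ Set.Ioo 0 R,
      HasDerivAt (fun r : ℝ => u (r • e)) (fderiv ℝ u (r • e) e) r := by
    intro r hr
    simpa using hasDerivAt_line (f := u) (x := 0) (w := e) (t := r)
      (by simpa using (hat r hr).differentiableAt (by norm_num))
  have hderiv : ∀ r ∈ Set.Ioo 0 R,
      derivWithin (fun r : ℝ => u (r • e)) (Set.Icc 0 R) r = fderiv ℝ u (r • e) e := by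
    intro r hr
    rw [derivWithin_of_mem_nhds (Icc_mem_nhds hr.1 hr.2), (hd r hr).deriv]
  refine ⟨derivWithin (fun r : ℝ => u (r • e)) (Set.Icc 0 R),
    fun r => iteratedFDeriv ℝ 2 u (r • e) ![e, e], hC1.continuousOn,
    hC1.continuousOn_derivWithin (uniqueDiffOn_Icc hR) le_rfl, ?_, ?_, ?_⟩
  · intro r hr
    rw [hderiv r hr]
    exact hd r hr
  · intro r hr
    have h1 := hasDerivAt_fderiv_line (hat r hr) e
    have h2 : HasDerivAt (fun s : ℝ => fderiv ℝ u (s • e) e)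
        (iteratedFDeriv ℝ 2 u (r • e) ![e, e]) r := by
      rw [← sub_self r] at h1
      have := h1.comp_sub_const r r
      simpa [← add_smul] using this
    refine h2.congr_of_eventuallyEq ?_
    filter_upwards [isOpen_Ioo.mem_nhds hr] with s hs using hderiv s hs
  · intro r hr
    rw [hderiv r hr, lap, ← Finset.add_sum_erase _ _ (Finset.mem_univ i₀)]
    congr 1
    rw [Finset.sum_congr rfl (g := fun _ => fderiv ℝ u (r • e) e / r)]
    · rw [Finset.sum_const, Finset.card_erase_of_mem (Finset.mem_univ i₀), Finset.card_univ,
        Fintype.card_fin, nsmul_eq_mul, Nat.cast_sub (Fin.pos i₀), Nat.cast_one]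
    · intro i hi
      refine iteratedFDeriv_two_tangential hrad hu2 he (by simp) ?_ hr
      have : i ≠ i₀ := Finset.ne_of_mem_erase hi
      simp [e, EuclideanSpace.inner_single_left, this.symm]

theorem stmt_16 (n : ℕ) (hn : 3 ≤ n) (p : ℝ) (hp : ((n : ℝ) + 2) / ((n : ℝ) - 2) ≤ p)
    (R : ℝ) (hR : 0 < R) :
    ¬ ∃ u v : EuclideanSpace ℝ (Fin n) → ℝ,
      (∀ x ∈ Metric.closedBall (0 : EuclideanSpace ℝ (Fin n)) R,
        ∀ y ∈ Metric.closedBall (0 : EuclideanSpace ℝ (Fin n)) R, ‖x‖ = ‖y‖ → u x = u y) ∧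
      (∀ x ∈ Metric.closedBall (0 : EuclideanSpace ℝ (Fin n)) R,
        ∀ y ∈ Metric.closedBall (0 : EuclideanSpace ℝ (Fin n)) R, ‖x‖ = ‖y‖ → v x = v y) ∧
      ContDiffOn ℝ 2 u (Metric.ball 0 R) ∧ ContDiffOn ℝ 1 u (Metric.closedBall 0 R) ∧
      ContDiffOn ℝ 2 v (Metric.ball 0 R) ∧ ContDiffOn ℝ 1 v (Metric.closedBall 0 R) ∧
      (∀ x ∈ Metric.ball (0 : EuclideanSpace ℝ (Fin n)) R, 0 < u x ∧ 0 < v x) ∧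
      (∀ x ∈ Metric.sphere (0 : EuclideanSpace ℝ (Fin n)) R, u x = 0 ∧ v x = 0) ∧
      (∀ x ∈ Metric.ball (0 : EuclideanSpace ℝ (Fin n)) R,
        -lap u x = Real.sqrt p * u x ^ (p - 1) * v x) ∧
      (∀ x ∈ Metric.ball (0 : EuclideanSpace ℝ (Fin n)) R,
        -lap v x = Real.sqrt p * u x ^ p) := by
  rintro ⟨u, v, hru, hrv, hu2, hu1, hv2, hv1, hpos, hbd, hequ, heqv⟩
  obtain ⟨k, rfl⟩ : ∃ k, n = k + 2 := ⟨n - 2, by omega⟩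
  have hk : 1 ≤ k := by omega
  have hk0 : (1 : ℝ) ≤ k := by exact_mod_cast hk
  have hp' : (k : ℝ) + 4 ≤ p * k := by
    push_cast at hp
    rw [div_le_iff₀ (by linarith)] at hp
    linarith
  have hp1 : 1 < p := by nlinarith
  obtain ⟨U', U'', cU, cU', dU, dU', lU⟩ :=
    exists_radial_profile (k + 2) (0 : Fin (k + 2)) hR hru hu2 hu1
  obtain ⟨V', V'', cV, cV', dV, dV', lV⟩ :=
    exists_radial_profile (k + 2) (0 : Fin (k + 2)) hR hrv hv2 hv1
  have hmem : ∀ r ∈ Set.Ioo 0 R, r • EuclideanSpace.single (0 : Fin (k + 2)) (1 : ℝ)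
      ∈ Metric.ball (0 : EuclideanSpace ℝ (Fin (k + 2))) R := fun r hr => by
    simpa [norm_smul, abs_of_pos hr.1] using hr.2
  have hRmem : R • EuclideanSpace.single (0 : Fin (k + 2)) (1 : ℝ)
      ∈ Metric.sphere (0 : EuclideanSpace ℝ (Fin (k + 2))) R := by
    simp [norm_smul, abs_of_pos hR]
  have hcast : (((k + 2 : ℕ) : ℝ) - 1) = k + 1 := by push_cast; ring
  refine radial_system_false k p hp1 hp' R hR _ U' U'' _ V' V'' cU cU' cV cV' dU dU' dV dV'
    (fun r hr => (hpos _ (hmem r hr)).1) (fun r hr => (hpos _ (hmem r hr)).2)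
    (hbd _ hRmem).1 (hbd _ hRmem).2 (fun r hr => ?_) (fun r hr => ?_)
  · rw [← hcast, ← lU r hr]
    exact hequ _ (hmem r hr)
  · rw [← hcast, ← lV r hr]
    exact heqv _ (hmem r hr)
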